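/- arXiv:1808.03932 — 4 statements merged into one kernel-verified Lean document; each statement's English description precedes it below -/
import Mathlib

section
/- Let G be a finite simple graph with n ≥ 1 vertices and k edges. Then β(G) ≥ n − 2k/n, and equality holds if and only if G has no edges or G is a complete multipartite graph all of whose parts have the same size. -/
noncomputable section

/-- The number of cliques of size `k` in `G` (the empty set is the unique clique of size 0). -/
def cliqueCount {V : Type*} [Fintype V] (G : SimpleGraph V) (k : ℕ) : ℕ :=
  Nat.card {s : Finset V // G.IsNClique k s}

/-- The clique number `ω(G)` of `G`. -/
def cliqueNum {V : Type*} [Fintype V] (G : SimpleGraph V) : ℕ :=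
  sSup {k : ℕ | ∃ s : Finset V, G.IsNClique k s}

/-- The PC-polynomial `PC(G,x) = ∑_{k=0}^{ω(G)} (-1)^k c_k(G) x^{ω(G)-k}`. -/
def PCpoly {V : Type*} [Fintype V] (G : SimpleGraph V) : Polynomial ℝ :=
  ∑ k ∈ Finset.range (cliqueNum G + 1),
    Polynomial.C ((-1 : ℝ) ^ k * (cliqueCount G k : ℝ)) * Polynomial.X ^ (cliqueNum G - k)

/-- `β(G)`, the largest real root of the PC-polynomial of `G`. -/
def beta {V : Type*} [Fintype V] (G : SimpleGraph V) : ℝ :=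
  sSup {x : ℝ | (PCpoly G).eval x = 0}

/-- `G` is a complete multipartite graph all of whose parts have the same size. -/
def IsCompleteMultipartiteEqualParts {V : Type*} [Fintype V] (G : SimpleGraph V) : Prop :=
  ∃ (r : ℕ) (f : V → Fin r),
    (∀ i j : Fin r, (Finset.univ.filter (fun v => f v = i)).card
        = (Finset.univ.filter (fun v => f v = j)).card) ∧
    (∀ u v : V, G.Adj u v ↔ f u ≠ f v)

section

open Finset
open scoped Classical

variable {V : Type*}

/-- The signed generating function of the cliques of `G` contained in `S`. -/
def signedCliqueSum (G : SimpleGraph V) (S : Finset V) (t : ℝ) : ℝ :=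
  ∑ K ∈ S.powerset, if G.IsClique (K : Set V) then (-t) ^ #K else 0

@[simp]
lemma signedCliqueSum_empty (G : SimpleGraph V) (t : ℝ) : signedCliqueSum G ∅ t = 1 := by
  simp [signedCliqueSum]

lemma signedCliqueSum_zero (G : SimpleGraph V) (S : Finset V) : signedCliqueSum G S 0 = 1 := by
  unfold signedCliqueSum
  rw [sum_eq_single ∅]
  · simp
  · intro K _ hK
    simp [hK]
  · simp

lemma continuous_signedCliqueSum (G : SimpleGraph V) (S : Finset V) :
    Continuous (signedCliqueSum G S) := by
  unfold signedCliqueSum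
  refine continuous_finsetSum _ fun K _ => ?_
  split_ifs <;> fun_prop

lemma signedCliqueSum_insert (G : SimpleGraph V) {S : Finset V} {u : V} (hu : u ∉ S) (t : ℝ) :
    signedCliqueSum G (insert u S) t
      = signedCliqueSum G S t - t * signedCliqueSum G {w ∈ S | G.Adj u w} t := by
  unfold signedCliqueSum
  rw [sum_powerset_insert hu, sub_eq_add_neg]
  congr 1
  rw [← neg_mul, mul_sum]
  symm
  refine sum_subset_zero_on_sdiff (powerset_mono.2 (filter_subset _ _)) ?_ ?_
  · intro K hK
    rw [mem_sdiff, mem_powerset, mem_powerset] at hK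
    rw [if_neg]
    rw [coe_insert, SimpleGraph.isClique_insert_of_notMem (fun h => hu (hK.1 h))]
    rintro ⟨-, h⟩
    exact hK.2 fun w hw => mem_filter.2 ⟨hK.1 hw, h w hw⟩
  · intro K hK
    rw [mem_powerset] at hK
    have huK : u ∉ K := fun h => hu (mem_filter.1 (hK h)).1
    have hadj : ∀ b ∈ (K : Set V), G.Adj u b := fun b hb => (mem_filter.1 (hK hb)).2
    have hins : G.IsClique ((insert u K : Finset V) : Set V) ↔ G.IsClique (K : Set V) := by
      rw [coe_insert, SimpleGraph.isClique_insert_of_notMem huK, and_iff_left hadj]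
    simp only [hins, card_insert_of_notMem huK, pow_succ', mul_ite, mul_zero]

/-- Positivity on an initial interval passes from a vertex set to its subsets. -/
lemma signedCliqueSum_pos_of_subset (G : SimpleGraph V) (S : Finset V) {t : ℝ}
    (h : ∀ s ∈ Set.Icc 0 t, 0 < signedCliqueSum G S s) {T : Finset V} (hT : T ⊆ S) :
    ∀ s ∈ Set.Icc 0 t, 0 < signedCliqueSum G T s := by
  induction S using Finset.strongInduction generalizing t T with
  | H S ih =>
    rcases hT.eq_or_ssubset with rfl | hlt
    · exact h
    obtain ⟨u, huS, huT⟩ := exists_of_ssubset hlt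
    have hss : S.erase u ⊂ S := erase_ssubset huS
    refine ih _ hss ?_ (subset_erase.2 ⟨hT, huT⟩)
    by_contra! hneg
    set f := signedCliqueSum G (S.erase u) with hf
    set g := signedCliqueSum G {w ∈ S.erase u | G.Adj u w} with hg
    have hcont : Continuous f := continuous_signedCliqueSum G _
    have hgcont : Continuous g := continuous_signedCliqueSum G _
    have hcomp : IsCompact (Set.Icc 0 t ∩ {s | f s ≤ 0}) :=
      isCompact_Icc.inter_right (isClosed_le hcont continuous_const)
    obtain ⟨s₀, ⟨hs₀, hfs₀⟩, hleast⟩ := hcomp.exists_isLeast hneg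
    have hs₀pos : 0 < s₀ := by
      refine lt_of_le_of_ne hs₀.1 ?_
      rintro rfl
      have : f 0 = 1 := signedCliqueSum_zero G _
      have : f 0 ≤ 0 := hfs₀
      linarith
    have hgpos : ∀ s ∈ Set.Ico 0 s₀, 0 < g s := by
      intro s hs
      have hmem : s ∈ Set.Icc 0 s := ⟨hs.1, le_rfl⟩
      refine ih _ hss (fun r hr => ?_) (filter_subset _ _) s hmem
      by_contra! hr'
      exact absurd (hleast ⟨⟨hr.1, hr.2.trans (hs.2.le.trans hs₀.2)⟩, hr'⟩)
        (not_le.2 (hr.2.trans_lt hs.2))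
    have hgs₀ : 0 ≤ g s₀ := by
      have hmem : s₀ ∈ closure (Set.Ico 0 s₀) := by
        rw [closure_Ico hs₀pos.ne]
        exact ⟨hs₀pos.le, le_rfl⟩
      exact closure_minimal (fun s hs => (hgpos s hs).le)
        (isClosed_le continuous_const hgcont) hmem
    have hrec := signedCliqueSum_insert G (notMem_erase u S) s₀
    rw [insert_erase huS, ← hf, ← hg] at hrec
    have hSpos := h s₀ hs₀
    have : f s₀ ≤ 0 := hfs₀
    nlinarith [mul_nonneg hs₀pos.le hgs₀]

lemma signedCliqueSum_anti {G : SimpleGraph V} {t : ℝ} (ht : 0 ≤ t)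
    (hpos : ∀ S, 0 < signedCliqueSum G S t) {S T : Finset V} (h : S ⊆ T) :
    signedCliqueSum G T t ≤ signedCliqueSum G S t := by
  induction T using Finset.strongInduction with
  | H T ih =>
    rcases h.eq_or_ssubset with rfl | hlt
    · rfl
    obtain ⟨u, huT, huS⟩ := exists_of_ssubset hlt
    have hrec := signedCliqueSum_insert G (notMem_erase u T) t
    rw [insert_erase huT] at hrec
    have := ih _ (erase_ssubset huT) (subset_erase.2 ⟨h, huS⟩)
    nlinarith [mul_nonneg ht (hpos {w ∈ T.erase u | G.Adj u w}).le]

lemma signedCliqueSum_of_independent (G : SimpleGraph V) (t : ℝ) (S : Finset V)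
    (h : ∀ u ∈ S, ∀ w ∈ S, ¬ G.Adj u w) : signedCliqueSum G S t = 1 - #S * t := by
  induction S using Finset.induction_on with
  | empty => simp
  | insert u S hu ih =>
    have hempty : {w ∈ S | G.Adj u w} = ∅ :=
      filter_eq_empty_iff.2 fun w hw => h u (mem_insert_self _ _) w (mem_insert_of_mem hw)
    rw [signedCliqueSum_insert G hu, hempty, signedCliqueSum_empty, card_insert_of_notMem hu,
      ih fun a ha b hb => h a (mem_insert_of_mem ha) b (mem_insert_of_mem hb)]
    push_cast
    ring

lemma signedCliqueSum_of_multipartite (G : SimpleGraph V) {ι : Type*} [Fintype ι] [DecidableEq ι]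
    (f : V → ι)
    (hf : ∀ u v, G.Adj u v ↔ f u ≠ f v) (S : Finset V) (t : ℝ) :
    signedCliqueSum G S t = ∏ i, (1 - #{v ∈ S | f v = i} * t) := by
  induction S using Finset.strongInduction with
  | H S ih =>
    rcases S.eq_empty_or_nonempty with rfl | ⟨u, hu⟩
    · simp
    have hrec := signedCliqueSum_insert G (notMem_erase u S) t
    rw [insert_erase hu, ih _ (erase_ssubset hu),
      ih _ ((filter_subset _ _).trans_ssubset (erase_ssubset hu))] at hrec
    rw [hrec]
    simp only [← mul_prod_erase univ _ (mem_univ (f u))]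
    have h₁ : {v ∈ {w ∈ S.erase u | G.Adj u w} | f v = f u} = ∅ := by
      ext v
      simp only [mem_filter, hf, notMem_empty, iff_false]
      rintro ⟨⟨-, h⟩, h'⟩
      exact h h'.symm
    have h₂ : ∀ i ∈ univ.erase (f u),
        {v ∈ {w ∈ S.erase u | G.Adj u w} | f v = i} = {v ∈ S | f v = i} ∧
        {v ∈ S.erase u | f v = i} = {v ∈ S | f v = i} := by
      intro i hi
      have hi' := (mem_erase.1 hi).1
      constructor
      · ext v
        simp only [mem_filter, hf, mem_erase]
        refine ⟨fun h => ⟨h.1.1.2, h.2⟩, ?_⟩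
        rintro ⟨hv, rfl⟩
        exact ⟨⟨⟨fun e => hi' (by rw [e]), hv⟩, hi'.symm⟩, rfl⟩
      · ext v
        simp only [mem_filter, mem_erase]
        refine ⟨fun h => ⟨h.1.2, h.2⟩, ?_⟩
        rintro ⟨hv, rfl⟩
        exact ⟨⟨fun e => hi' (by rw [e]), hv⟩, rfl⟩
    have h₃ : {v ∈ S | f v = f u} = insert u {v ∈ S.erase u | f v = f u} := by
      conv_lhs => rw [← insert_erase hu, filter_insert, if_pos rfl]
    rw [h₁, h₃, card_insert_of_notMem (by simp),
      prod_congr (s₁ := univ.erase (f u)) (f := fun i => 1 - (#{v ∈ S.erase u | f v = i} : ℝ) * t)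
        rfl fun i hi => by rw [(h₂ i hi).2],
      prod_congr (s₁ := univ.erase (f u))
        (f := fun i => 1 - (#{v ∈ {w ∈ S.erase u | G.Adj u w} | f v = i} : ℝ) * t)
        rfl fun i hi => by rw [(h₂ i hi).1]]
    push_cast
    simp only [card_empty]
    ring

variable [Fintype V]

/-- The vertices not adjacent to `v`, including `v` itself. -/
def nonNeighbors (G : SimpleGraph V) (v : V) : Finset V := {u | ¬ G.Adj v u}

@[simp]
lemma mem_nonNeighbors {G : SimpleGraph V} {u v : V} : u ∈ nonNeighbors G v ↔ ¬ G.Adj v u := by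
  simp [nonNeighbors]

lemma self_mem_nonNeighbors (G : SimpleGraph V) (v : V) : v ∈ nonNeighbors G v := by simp

lemma card_nonNeighbors (G : SimpleGraph V) (v : V) :
    (#(nonNeighbors G v) : ℝ) = Fintype.card V - G.degree v := by
  rw [eq_sub_iff_add_eq, ← G.card_neighborFinset_eq_degree, G.neighborFinset_eq_filter]
  have := card_filter_add_card_filter_not (s := (univ : Finset V)) (fun u => G.Adj v u)
  rw [card_univ] at this
  unfold nonNeighbors
  rw [← this]
  push_cast
  ring

lemma sum_card_nonNeighbors (G : SimpleGraph V) :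
    ∑ v, (#(nonNeighbors G v) : ℝ) = (Fintype.card V : ℝ) ^ 2 - 2 * Nat.card G.edgeSet := by
  simp only [card_nonNeighbors, sum_sub_distrib]
  rw [← Nat.cast_sum univ (fun v => G.degree v), G.sum_degrees_eq_twice_card_edges,
    Nat.card_eq_fintype_card,
    ← SimpleGraph.edgeFinset_card]
  simp [sq]

lemma sum_card_nonNeighbors_le_sum_div (G : SimpleGraph V) {y : V → ℝ} (hy : ∀ v, 0 < y v) :
    ∑ v, (#(nonNeighbors G v) : ℝ) ≤ ∑ v, (∑ u ∈ nonNeighbors G v, y u) / y v := by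
  have hswap : ∑ v, ∑ u ∈ nonNeighbors G v, y u / y v
      = ∑ v, ∑ u ∈ nonNeighbors G v, y v / y u :=
    sum_comm' (by simp [G.adj_comm])
  have hle : ∑ v, ∑ u ∈ nonNeighbors G v, (2 : ℝ)
      ≤ ∑ v, ∑ u ∈ nonNeighbors G v, (y u / y v + y v / y u) := by
    refine sum_le_sum fun v _ => sum_le_sum fun u _ => ?_
    rw [div_add_div _ _ (hy v).ne' (hy u).ne', le_div_iff₀ (mul_pos (hy v) (hy u))]
    nlinarith [sq_nonneg (y u - y v)]
  simp only [sum_add_distrib, ← hswap, sum_const, nsmul_eq_mul, ← sum_mul] at hle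
  simp only [sum_div]
  linarith

/-- Removing the vertices of `D` one at a time bounds the signed clique sum from below. -/
lemma add_sum_le_signedCliqueSum {G : SimpleGraph V} {t : ℝ} (ht : 0 ≤ t)
    (hpos : ∀ S, 0 < signedCliqueSum G S t) (S D : Finset V) (h : Disjoint S D) :
    signedCliqueSum G (S ∪ D) t + t * ∑ u ∈ D, signedCliqueSum G {w | G.Adj u w} t
      ≤ signedCliqueSum G S t := by
  induction D using Finset.induction_on with
  | empty => simp
  | insert u D hu ih =>
    rw [disjoint_insert_right] at h
    have huSD : u ∉ S ∪ D := by simp [h.1, hu]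
    rw [union_insert, signedCliqueSum_insert G huSD, sum_insert hu]
    have := signedCliqueSum_anti ht hpos
      (filter_subset_filter (fun w => G.Adj u w) (subset_univ (S ∪ D)))
    nlinarith [ih h.2, mul_le_mul_of_nonneg_left this ht]

lemma add_sum_nonNeighbors_le {G : SimpleGraph V} {t : ℝ} (ht : 0 ≤ t)
    (hpos : ∀ S, 0 < signedCliqueSum G S t) (v : V) :
    t * ∑ u ∈ nonNeighbors G v, signedCliqueSum G {w | G.Adj u w} t
      ≤ signedCliqueSum G {w | G.Adj v w} t := by
  have hdisj : Disjoint ({w | G.Adj v w} : Finset V) (nonNeighbors G v) :=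
    disjoint_filter_filter_not _ _ _
  linarith [add_sum_le_signedCliqueSum ht hpos _ _ hdisj,
    hpos (({w | G.Adj v w} : Finset V) ∪ nonNeighbors G v)]

/-- An edge among the non-neighbors of `v` improves `add_sum_nonNeighbors_le`. -/
lemma add_sum_nonNeighbors_add_le {G : SimpleGraph V} {t : ℝ} (ht : 0 ≤ t)
    (hpos : ∀ S, 0 < signedCliqueSum G S t) {v a b : V} (ha : ¬ G.Adj v a) (hb : ¬ G.Adj v b)
    (hab : G.Adj a b) :
    t * ∑ u ∈ nonNeighbors G v, signedCliqueSum G {w | G.Adj u w} t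
        + t ^ 3 * signedCliqueSum G {w | G.Adj v w} t
      ≤ signedCliqueSum G {w | G.Adj v w} t := by
  set N : V → Finset V := fun u => {w | G.Adj u w} with hN
  set D := ((nonNeighbors G v).erase a).erase b with hD
  have hbD : b ∈ (nonNeighbors G v).erase a := by simp [hab.ne', hb]
  have haD : a ∈ nonNeighbors G v := by simpa
  have hdisj : Disjoint (N v) D := by
    refine Disjoint.mono_right ((erase_subset _ _).trans (erase_subset _ _)) ?_
    exact disjoint_filter_filter_not _ _ _
  have hunion : N v ∪ D = (univ.erase b).erase a := by
    ext w
    simp only [hN, hD, mem_union, mem_filter, mem_univ, true_and, mem_erase, mem_nonNeighbors]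
    refine ⟨?_, fun h => ?_⟩
    · rintro (h | h)
      · exact ⟨fun e => ha (e ▸ h), fun e => hb (e ▸ h), trivial⟩
      · exact ⟨h.2.1, h.1, trivial⟩
    · by_cases hw : G.Adj v w
      · exact Or.inl hw
      · exact Or.inr ⟨h.2.1, h.1, hw⟩
  have hrest := add_sum_le_signedCliqueSum ht hpos _ _ hdisj
  rw [hunion] at hrest
  have hsum : ∑ u ∈ nonNeighbors G v, signedCliqueSum G (N u) t
      = signedCliqueSum G (N a) t + (signedCliqueSum G (N b) t
        + ∑ u ∈ D, signedCliqueSum G (N u) t) := by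
    rw [hD, add_sum_erase _ (fun u => signedCliqueSum G (N u) t) hbD,
      add_sum_erase _ (fun u => signedCliqueSum G (N u) t) haD]
  have hstepb := signedCliqueSum_insert G (notMem_erase b univ) t
  rw [insert_erase (mem_univ b)] at hstepb
  have hfilterb : ({w ∈ univ.erase b | G.Adj b w} : Finset V) = N b := by
    ext w
    simp only [hN, mem_filter, mem_erase, mem_univ, true_and, and_true]
    exact ⟨fun h => h.2, fun h => ⟨h.ne', h⟩⟩
  rw [hfilterb] at hstepb
  have hstepa := signedCliqueSum_insert G (notMem_erase a (univ.erase b)) t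
  rw [insert_erase (by simp [hab.ne])] at hstepa
  have hfiltera : ({w ∈ (univ.erase b).erase a | G.Adj a w} : Finset V) = (N a).erase b := by
    ext w
    simp only [hN, mem_filter, mem_erase, mem_univ, true_and, and_true]
    exact ⟨fun h => ⟨h.1.2, h.2⟩, fun h => ⟨⟨h.2.ne', h.1⟩, h.2⟩⟩
  rw [hfiltera] at hstepa
  have hstepab := signedCliqueSum_insert G (notMem_erase b (N a)) t
  rw [insert_erase (by simpa [hN] using hab)] at hstepab
  have hstepv := signedCliqueSum_insert G (notMem_erase v univ) t
  rw [insert_erase (mem_univ v)] at hstepv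
  have hfilterv : ({w ∈ univ.erase v | G.Adj v w} : Finset V) = N v := by
    ext w
    simp only [hN, mem_filter, mem_erase, mem_univ, true_and, and_true]
    exact ⟨fun h => h.2, fun h => ⟨h.ne', h⟩⟩
  rw [hfilterv] at hstepv
  have hcommon : signedCliqueSum G (univ.erase v) t
      ≤ signedCliqueSum G {w ∈ (N a).erase b | G.Adj b w} t := by
    refine signedCliqueSum_anti ht hpos fun w hw => ?_
    simp only [hN, mem_filter, mem_erase, mem_univ, true_and, and_true] at hw ⊢
    rintro rfl
    exact ha hw.1.2.symm
  have hlow : t * signedCliqueSum G (N v) t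
      ≤ signedCliqueSum G {w ∈ (N a).erase b | G.Adj b w} t := by
    linarith [hpos univ]
  rw [hsum]
  have := mul_le_mul_of_nonneg_left hlow (sq_nonneg t)
  nlinarith [hpos univ]

lemma mul_sum_card_nonNeighbors_le {G : SimpleGraph V} {t : ℝ} (ht : 0 ≤ t)
    (hpos : ∀ S, 0 < signedCliqueSum G S t) (δ : V → ℝ)
    (h : ∀ v, t * ∑ u ∈ nonNeighbors G v, signedCliqueSum G {w | G.Adj u w} t
        + δ v * signedCliqueSum G {w | G.Adj v w} t ≤ signedCliqueSum G {w | G.Adj v w} t) :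
    t * ∑ v, (#(nonNeighbors G v) : ℝ) + ∑ v, δ v ≤ Fintype.card V := by
  calc t * ∑ v, (#(nonNeighbors G v) : ℝ) + ∑ v, δ v
      ≤ t * ∑ v, (∑ u ∈ nonNeighbors G v, signedCliqueSum G {w | G.Adj u w} t)
          / signedCliqueSum G {w | G.Adj v w} t + ∑ v, δ v := by
        refine add_le_add_left (mul_le_mul_of_nonneg_left ?_ ht) _
        exact sum_card_nonNeighbors_le_sum_div G
          (y := fun v => signedCliqueSum G {w | G.Adj v w} t) fun v => hpos _
    _ = ∑ v, (t * ((∑ u ∈ nonNeighbors G v, signedCliqueSum G {w | G.Adj u w} t)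
          / signedCliqueSum G {w | G.Adj v w} t) + δ v) := by
        rw [sum_add_distrib, mul_sum]
    _ ≤ ∑ _v : V, (1 : ℝ) := by
        refine sum_le_sum fun v _ => ?_
        have hv := hpos {w | G.Adj v w}
        rw [← mul_div_assoc, div_add' _ _ _ hv.ne', div_le_one hv]
        exact h v
    _ = Fintype.card V := by simp

lemma card_le_cliqueNum {G : SimpleGraph V} {K : Finset V} (hK : G.IsClique (K : Set V)) :
    #K ≤ cliqueNum G := by
  refine le_csSup ⟨Fintype.card V, ?_⟩ ⟨K, hK, rfl⟩
  rintro k ⟨s, hs⟩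
  exact hs.card_eq ▸ card_le_univ s

lemma eval_PCpoly (G : SimpleGraph V) {x : ℝ} (hx : x ≠ 0) :
    (PCpoly G).eval x = x ^ cliqueNum G * signedCliqueSum G univ x⁻¹ := by
  have hgroup : signedCliqueSum G univ x⁻¹
      = ∑ k ∈ range (cliqueNum G + 1), (cliqueCount G k : ℝ) * (-x⁻¹) ^ k := by
    unfold signedCliqueSum
    rw [← sum_filter, ← sum_fiberwise_of_maps_to (t := range (cliqueNum G + 1)) (g := card)]
    · refine sum_congr rfl fun k _ => ?_
      rw [sum_congr rfl (g := fun _ => (-x⁻¹) ^ k), sum_const, nsmul_eq_mul, cliqueCount,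
        Nat.card_eq_fintype_card, Fintype.card_subtype]
      · congr 3
        ext K
        simp [SimpleGraph.isNClique_iff]
      · intro K hK
        rw [(mem_filter.1 hK).2]
    · intro K hK
      exact mem_range_succ_iff.2 (card_le_cliqueNum (mem_filter.1 hK).2)
  rw [hgroup, PCpoly, Polynomial.eval_finsetSum, mul_sum]
  refine sum_congr rfl fun k hk => ?_
  have hk' : k ≤ cliqueNum G := mem_range_succ_iff.1 hk
  simp only [Polynomial.eval_mul, Polynomial.eval_C, Polynomial.eval_pow, Polynomial.eval_X]
  rw [pow_sub₀ _ hx hk', neg_pow x⁻¹, inv_pow]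
  ring

lemma bddAbove_roots_PCpoly (G : SimpleGraph V) :
    BddAbove {x : ℝ | (PCpoly G).eval x = 0} := by
  have hlim : Filter.Tendsto (fun x : ℝ => signedCliqueSum G univ x⁻¹) Filter.atTop (nhds 1) := by
    have := ((continuous_signedCliqueSum G univ).tendsto 0).comp
      (tendsto_inv_atTop_zero (𝕜 := ℝ))
    rwa [signedCliqueSum_zero] at this
  obtain ⟨M, hM⟩ := Filter.eventually_atTop.1
    ((hlim.eventually_const_lt one_pos).and (Filter.eventually_gt_atTop 0))
  refine ⟨M, fun x hx => ?_⟩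
  by_contra! hlt
  obtain ⟨h₁, h₂⟩ := hM x hlt.le
  rw [Set.mem_ofPred_eq, eval_PCpoly G h₂.ne'] at hx
  exact (mul_pos (pow_pos h₂ _) h₁).ne' hx

lemma signedCliqueSum_pos {G : SimpleGraph V} {x : ℝ} (hx₀ : 0 < x) (hx : beta G < x)
    (S : Finset V) : 0 < signedCliqueSum G S x⁻¹ := by
  refine signedCliqueSum_pos_of_subset G univ (t := x⁻¹) ?_ (subset_univ S) _
    ⟨(inv_pos.2 hx₀).le, le_rfl⟩
  intro s hs
  by_contra! hneg
  obtain ⟨r, hr, hr₀⟩ := intermediate_value_Icc' hs.1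
    (continuous_signedCliqueSum G univ).continuousOn
    (show (0 : ℝ) ∈ Set.Icc _ _ from ⟨hneg, by rw [signedCliqueSum_zero]; exact zero_le_one⟩)
  have hrpos : 0 < r := by
    refine lt_of_le_of_ne hr.1 ?_
    rintro rfl
    rw [signedCliqueSum_zero] at hr₀
    exact one_ne_zero hr₀
  have hroot : (PCpoly G).eval r⁻¹ = 0 := by
    rw [eval_PCpoly G (inv_pos.2 hrpos).ne', inv_inv, hr₀, mul_zero]
  have hle : r⁻¹ ≤ beta G := le_csSup (bddAbove_roots_PCpoly G) hroot
  have : x ≤ r⁻¹ := (le_inv_comm₀ hrpos hx₀).1 (hr.2.trans hs.2)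
  linarith

lemma sum_card_nonNeighbors_le {G : SimpleGraph V} {x : ℝ} (hx₀ : 0 < x) (hx : beta G < x) :
    ∑ v, (#(nonNeighbors G v) : ℝ) ≤ Fintype.card V * x := by
  have ht := (inv_pos.2 hx₀).le
  have := mul_sum_card_nonNeighbors_le ht (signedCliqueSum_pos hx₀ hx) 0
    fun v => by simpa using add_sum_nonNeighbors_le ht (signedCliqueSum_pos hx₀ hx) v
  simp only [Pi.zero_apply, sum_const_zero, add_zero] at this
  rwa [inv_mul_le_iff₀ hx₀, mul_comm] at this

lemma sum_card_nonNeighbors_add_le {G : SimpleGraph V} {x : ℝ} (hx₀ : 0 < x) (hx : beta G < x)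
    {v a b : V} (ha : ¬ G.Adj v a) (hb : ¬ G.Adj v b) (hab : G.Adj a b) :
    ∑ v, (#(nonNeighbors G v) : ℝ) + (x ^ 2)⁻¹ ≤ Fintype.card V * x := by
  have ht := (inv_pos.2 hx₀).le
  have hpos := signedCliqueSum_pos hx₀ hx
  have := mul_sum_card_nonNeighbors_le ht hpos (fun u => if u = v then x⁻¹ ^ 3 else 0) ?_
  · rw [sum_ite_eq' univ v, if_pos (mem_univ v)] at this
    have h := mul_le_mul_of_nonneg_left this hx₀.le
    have e : x * (x⁻¹ * ∑ v, (#(nonNeighbors G v) : ℝ) + x⁻¹ ^ 3)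
        = ∑ v, (#(nonNeighbors G v) : ℝ) + (x ^ 2)⁻¹ := by
      field_simp
    rw [e] at h
    linarith
  · intro u
    split_ifs with huv
    · subst huv
      exact add_sum_nonNeighbors_add_le ht hpos ha hb hab
    · simpa using add_sum_nonNeighbors_le ht hpos u

lemma sum_card_nonNeighbors_pos [Nonempty V] (G : SimpleGraph V) :
    0 < ∑ v, (#(nonNeighbors G v) : ℝ) :=
  sum_pos (fun v _ => Nat.cast_pos.2 (card_pos.2 ⟨v, self_mem_nonNeighbors G v⟩))
    univ_nonempty

lemma sum_card_nonNeighbors_le_mul_beta [Nonempty V] (G : SimpleGraph V) :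
    ∑ v, (#(nonNeighbors G v) : ℝ) ≤ Fintype.card V * beta G := by
  have hn : (0 : ℝ) < Fintype.card V := Nat.cast_pos.2 Fintype.card_pos
  have hmax : (∑ v, (#(nonNeighbors G v) : ℝ)) / Fintype.card V ≤ max (beta G) 0 := by
    refine le_of_forall_gt_imp_ge_of_dense fun x hx => ?_
    rw [div_le_iff₀' hn]
    exact sum_card_nonNeighbors_le ((le_max_right _ _).trans_lt hx)
      ((le_max_left _ _).trans_lt hx)
  have hdiv := div_pos (sum_card_nonNeighbors_pos G) hn
  rcases le_max_iff.1 hmax with h | h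
  · rwa [div_le_iff₀' hn] at h
  · linarith

lemma beta_pos [Nonempty V] (G : SimpleGraph V) : 0 < beta G := by
  have hn : (0 : ℝ) < Fintype.card V := Nat.cast_pos.2 Fintype.card_pos
  exact pos_of_mul_pos_right ((sum_card_nonNeighbors_pos G).trans_le
    (sum_card_nonNeighbors_le_mul_beta G)) hn.le

lemma not_adj_trans_of_eq [Nonempty V] {G : SimpleGraph V}
    (h : ∑ v, (#(nonNeighbors G v) : ℝ) = Fintype.card V * beta G) {v a b : V}
    (ha : ¬ G.Adj v a) (hb : ¬ G.Adj v b) : ¬ G.Adj a b := by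
  intro hab
  have hβ := beta_pos G
  have hn : (0 : ℝ) < Fintype.card V := Nat.cast_pos.2 Fintype.card_pos
  set c : ℝ := ((beta G + 1) ^ 2)⁻¹ with hc
  have hcpos : 0 < c := by positivity
  set ε : ℝ := min (c / (2 * Fintype.card V)) 1 with hε
  have hεpos : 0 < ε := by positivity
  have hx := sum_card_nonNeighbors_add_le (x := beta G + ε) (by positivity) (by linarith) ha hb hab
  have hcle : c ≤ ((beta G + ε) ^ 2)⁻¹ := by
    rw [hc]
    gcongr
    exact min_le_right _ _
  have hεle : Fintype.card V * ε ≤ c / 2 := by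
    calc Fintype.card V * ε ≤ Fintype.card V * (c / (2 * Fintype.card V)) := by
          gcongr
          exact min_le_left _ _
      _ = c / 2 := by field_simp
  rw [h] at hx
  linarith

lemma card_nonNeighbors_eq_beta [Nonempty V] {G : SimpleGraph V}
    (h : ∑ v, (#(nonNeighbors G v) : ℝ) = Fintype.card V * beta G) (v : V) :
    (#(nonNeighbors G v) : ℝ) = beta G := by
  have hle : ∀ v ∈ univ, (#(nonNeighbors G v) : ℝ) ≤ beta G := by
    intro v _
    refine le_of_forall_gt_imp_ge_of_dense fun x hx => ?_
    have hx₀ := (beta_pos G).trans hx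
    have hpos := signedCliqueSum_pos hx₀ hx (nonNeighbors G v)
    rw [signedCliqueSum_of_independent _ _ _ fun a ha b hb =>
      not_adj_trans_of_eq h (mem_nonNeighbors.1 ha) (mem_nonNeighbors.1 hb), sub_pos,
      ← div_eq_mul_inv, div_lt_one hx₀] at hpos
    exact hpos.le
  refine (sum_eq_sum_iff_of_le hle).1 ?_ v (mem_univ v)
  simpa using h

lemma isCompleteMultipartiteEqualParts_of_eq [Nonempty V] {G : SimpleGraph V}
    (h : ∑ v, (#(nonNeighbors G v) : ℝ) = Fintype.card V * beta G) :
    IsCompleteMultipartiteEqualParts G := by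
  let s : Setoid V :=
    { r := fun u v => ¬ G.Adj u v
      iseqv := ⟨fun u => G.loopless.irrefl u, fun {u v} huv hvu => huv hvu.symm,
        fun {u v w} huv hvw => not_adj_trans_of_eq h (fun hvu => huv hvu.symm) hvw⟩ }
  let e := Fintype.equivFin (Quotient s)
  have hadj : ∀ u v : V, G.Adj u v ↔ e (Quotient.mk s u) ≠ e (Quotient.mk s v) := by
    intro u v
    rw [Ne, e.apply_eq_iff_eq, Quotient.eq]
    exact not_not.symm
  refine ⟨_, fun v => e (Quotient.mk s v), ?_, hadj⟩
  have hcard : ∀ i, ((univ.filter fun v => e (Quotient.mk s v) = i).card : ℝ) = beta G := by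
    intro i
    obtain ⟨v, hv⟩ := Quotient.exists_rep (e.symm i)
    rw [← card_nonNeighbors_eq_beta h v]
    congr 2
    ext u
    rw [mem_filter, mem_nonNeighbors, hadj, not_not, hv, e.apply_symm_apply, eq_comm]
    simp
  intro i j
  exact_mod_cast (hcard i).trans (hcard j).symm

lemma mul_beta_le_of_isCompleteMultipartiteEqualParts [Nonempty V] {G : SimpleGraph V}
    (h : IsCompleteMultipartiteEqualParts G) :
    Fintype.card V * beta G ≤ ∑ v, (#(nonNeighbors G v) : ℝ) := by
  obtain ⟨r, f, hf, hadj⟩ := h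
  have hfiber : ∀ v, nonNeighbors G v = univ.filter fun u => f u = f v := by
    intro v
    ext u
    simp [hadj, eq_comm]
  obtain ⟨v₀⟩ := ‹Nonempty V›
  set d : ℝ := ((#(nonNeighbors G v₀) : ℕ) : ℝ) with hd
  have hcard : ∀ i, (#(univ.filter fun u => f u = i) : ℝ) = d := by
    intro i
    rw [hd, hfiber, hf i (f v₀)]
  have hdpos : 0 < d := Nat.cast_pos.2 (card_pos.2 ⟨v₀, self_mem_nonNeighbors G v₀⟩)
  have hβ : beta G ≤ d := by
    refine Real.sSup_le (fun x hx => ?_) hdpos.le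
    by_contra! hlt
    have hx₀ : 0 < x := hdpos.trans hlt
    rw [Set.mem_ofPred_eq, eval_PCpoly G hx₀.ne',
      signedCliqueSum_of_multipartite G f hadj] at hx
    refine (mul_pos (pow_pos hx₀ _) (prod_pos fun i _ => ?_)).ne' hx
    rw [hcard i, sub_pos, ← div_eq_mul_inv, div_lt_one hx₀]
    exact hlt
  simp only [hfiber, hcard, sum_const, nsmul_eq_mul, card_univ]
  gcongr

lemma isCompleteMultipartiteEqualParts_bot :
    IsCompleteMultipartiteEqualParts (⊥ : SimpleGraph V) :=
  ⟨1, fun _ => 0, fun i j => by rw [Subsingleton.elim i j], by simp⟩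

end

/-- `β(G) ≥ n - 2k/n` where `k` is the number of edges, with equality iff `G` is
edgeless or a complete multipartite graph with equal parts. -/
theorem stmt_11 {V : Type*} [Fintype V] [Nonempty V] (G : SimpleGraph V) :
    ((Fintype.card V : ℝ) - 2 * (Nat.card G.edgeSet : ℝ) / (Fintype.card V : ℝ)
        ≤ beta G) ∧
    (beta G
        = (Fintype.card V : ℝ) - 2 * (Nat.card G.edgeSet : ℝ) / (Fintype.card V : ℝ) ↔
      G = ⊥ ∨ IsCompleteMultipartiteEqualParts G) := by
  have hn : (0 : ℝ) < Fintype.card V := Nat.cast_pos.2 Fintype.card_pos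
  have hsum := sum_card_nonNeighbors G
  have havg : (Fintype.card V : ℝ) - 2 * (Nat.card G.edgeSet : ℝ) / (Fintype.card V : ℝ)
      = (∑ v, ((nonNeighbors G v).card : ℝ)) / Fintype.card V := by
    rw [hsum]
    field_simp
  have hle := sum_card_nonNeighbors_le_mul_beta G
  rw [havg]
  refine ⟨(div_le_iff₀' hn).2 hle, fun h => Or.inr ?_, fun h => ?_⟩
  · exact isCompleteMultipartiteEqualParts_of_eq ((eq_div_iff hn.ne').1 h ▸ mul_comm _ _)
  · have hparts : IsCompleteMultipartiteEqualParts G := by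
      rcases h with rfl | h
      · exact isCompleteMultipartiteEqualParts_bot
      · exact h
    rw [eq_div_iff hn.ne', mul_comm]
    exact le_antisymm (mul_beta_le_of_isCompleteMultipartiteEqualParts hparts) hle
end
end

section
/- If G is a finite simple claw-free graph (G has no induced subgraph isomorphic to the star K_{1,3}), then all complex roots of the independence polynomial I(G,x) are real. -/
noncomputable section

/-- `s_k(G)`: the number of independent sets of size `k` in `G`
(= cliques of size `k` in the complement), with `s_0(G) = 1`. -/
def indepCount {V : Type*} [Fintype V] (G : SimpleGraph V) (k : ℕ) : ℕ :=
  Nat.card {s : Finset V // Gᶜ.IsNClique k s}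

/-- The independence polynomial `I(G,x) = ∑_k s_k(G) x^k`. -/
def indepPoly {V : Type*} [Fintype V] (G : SimpleGraph V) : Polynomial ℝ :=
  ∑ k ∈ Finset.range (Fintype.card V + 1),
    Polynomial.C (indepCount G k : ℝ) * Polynomial.X ^ k

namespace SimpleGraph

open Finset
open scoped Classical ComplexConjugate

variable {V : Type*} (G : SimpleGraph V)

/-- `D` is a union of connected components of the subgraph of `G` induced on `U`. -/
def IsClosedIn (U D : Finset V) : Prop :=
  D ⊆ U ∧ ∀ a ∈ D, ∀ b ∈ U, G.Adj a b → b ∈ D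

/-- `C` is nonempty and induces a connected subgraph of `G`. -/
def IsConnectedOn (C : Finset V) : Prop :=
  C.Nonempty ∧ ∀ D, G.IsClosedIn C D → D.Nonempty → D = C

/-- `C` is the vertex set of a connected component of the subgraph of `G` induced on `U`. -/
def IsComponentOf (U C : Finset V) : Prop :=
  G.IsClosedIn U C ∧ G.IsConnectedOn C

/-- The independent sets of `G` contained in `S`. -/
def indepSetsIn (S : Finset V) : Finset (Finset V) :=
  S.powerset.filter fun A => G.IsIndepSet (A : Set V)

/-- The value at `x` of the independence polynomial of the subgraph of `G` induced on `S`. -/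
def indepSum (S : Finset V) (x : ℂ) : ℂ :=
  ∑ A ∈ G.indepSetsIn S, x ^ #A

/-- The vertices of `S` outside the closed neighbourhood of `C`. -/
def farFrom (S C : Finset V) : Finset V :=
  S.filter fun v => v ∉ C ∧ ∀ c ∈ C, ¬ G.Adj c v

/-- The pairs of independent sets of `G` with union `C`. -/
def indepPairs (C : Finset V) : Finset (Finset V × Finset V) :=
  (G.indepSetsIn C ×ˢ G.indepSetsIn C).filter fun p => p.1 ∪ p.2 = C

/-- The sum of `(|P| - |Q|) x ^ |P| y ^ |Q|` over the pairs of independent sets with union `C`. -/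
def pairWeight (C : Finset V) (x y : ℂ) : ℂ :=
  ∑ p ∈ G.indepPairs C, ((#p.1 : ℂ) - #p.2) * (x ^ #p.1 * y ^ #p.2)

variable {G}

lemma mem_indepSetsIn {S A : Finset V} :
    A ∈ G.indepSetsIn S ↔ A ⊆ S ∧ G.IsIndepSet (A : Set V) := by
  simp [indepSetsIn]

lemma mem_farFrom {S C : Finset V} {v : V} :
    v ∈ G.farFrom S C ↔ v ∈ S ∧ v ∉ C ∧ ∀ c ∈ C, ¬ G.Adj c v := by
  simp [farFrom]

lemma mem_indepPairs {C : Finset V} {p : Finset V × Finset V} :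
    p ∈ G.indepPairs C ↔
      G.IsIndepSet (p.1 : Set V) ∧ G.IsIndepSet (p.2 : Set V) ∧ p.1 ∪ p.2 = C := by
  simp only [indepPairs, mem_filter, mem_product, mem_indepSetsIn]
  constructor
  · tauto
  · rintro ⟨h1, h2, rfl⟩
    exact ⟨⟨⟨subset_union_left, h1⟩, subset_union_right, h2⟩, rfl⟩

lemma isIndepSet_finset_iff {A : Finset V} :
    G.IsIndepSet (A : Set V) ↔ ∀ a ∈ A, ∀ b ∈ A, ¬ G.Adj a b := by
  refine ⟨fun h a ha b hb hab => h ha hb hab.ne hab, fun h a ha b hb _ => h a ha b hb⟩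

lemma isConnectedOn_singleton (v : V) : G.IsConnectedOn {v} := by
  refine ⟨singleton_nonempty v, fun D hD hne => ?_⟩
  exact (subset_singleton_iff.mp hD.1).resolve_left hne.ne_empty

lemma exists_isComponentOf {U : Finset V} {v : V} (hv : v ∈ U) :
    ∃ C, G.IsComponentOf U C ∧ v ∈ C := by
  obtain ⟨C, hC, hmin⟩ := exists_min_image
    (U.powerset.filter fun D => G.IsClosedIn U D ∧ v ∈ D) card
    ⟨U, mem_filter.mpr ⟨mem_powerset_self U, ⟨Subset.rfl, fun _ _ _ hb _ => hb⟩, hv⟩⟩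
  simp only [mem_filter, mem_powerset] at hC hmin
  obtain ⟨hCU, hcl, hvC⟩ := hC
  refine ⟨C, ⟨hcl, ⟨v, hvC⟩, fun D hD hne => ?_⟩, hvC⟩
  by_cases hvD : v ∈ D
  · have hDcl : G.IsClosedIn U D :=
      ⟨hD.1.trans hCU, fun a ha b hb hab => hD.2 a ha b (hcl.2 a (hD.1 ha) b hb hab) hab⟩
    exact eq_of_subset_of_card_le hD.1 (hmin D ⟨hDcl.1, hDcl, hvD⟩)
  · have hDcl : G.IsClosedIn U (C \ D) := by
      refine ⟨sdiff_subset.trans hCU, fun a ha b hb hab => ?_⟩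
      rw [mem_sdiff] at ha ⊢
      exact ⟨hcl.2 a ha.1 b hb hab, fun hbD => ha.2 (hD.2 b hbD a ha.1 hab.symm)⟩
    have h1 := hmin _ ⟨hDcl.1, hDcl, mem_sdiff.mpr ⟨hvC, hvD⟩⟩
    have h2 := card_sdiff_add_card_eq_card hD.1
    have h3 := hne.card_pos
    omega

lemma IsComponentOf.subset_of_mem {U C C' : Finset V} (h : G.IsComponentOf U C)
    (h' : G.IsComponentOf U C') {v : V} (hv : v ∈ C) (hv' : v ∈ C') : C ⊆ C' := by
  have : C ∩ C' = C := by
    refine h.2.2 _ ⟨inter_subset_left, fun a ha b hb hab => ?_⟩ ⟨v, mem_inter.mpr ⟨hv, hv'⟩⟩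
    exact mem_inter.mpr ⟨hb, h'.1.2 a (mem_inter.mp ha).2 b (h.1.1 hb) hab⟩
  exact inter_eq_left.mp this

lemma card_eq_sum_card_inter_component {S U A : Finset V} (hU : U ⊆ S) (hA : A ⊆ U) :
    #A = ∑ C ∈ S.powerset.filter (G.IsComponentOf U), #(A ∩ C) := by
  have key : ∀ v ∈ A, #((S.powerset.filter (G.IsComponentOf U)).filter (v ∈ ·)) = 1 := by
    intro v hv
    obtain ⟨C, hC, hvC⟩ := exists_isComponentOf (G := G) (hA hv)
    rw [card_eq_one]
    refine ⟨C, ?_⟩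
    ext C'
    simp only [mem_filter, mem_powerset, mem_singleton]
    constructor
    · rintro ⟨⟨-, hC'⟩, hvC'⟩
      exact (hC'.subset_of_mem hC hvC' hvC).antisymm (hC.subset_of_mem hC' hvC hvC')
    · rintro rfl
      exact ⟨⟨hC.1.1.trans hU, hC⟩, hvC⟩
  calc #A = ∑ v ∈ A, #((S.powerset.filter (G.IsComponentOf U)).filter (v ∈ ·)) := by
        rw [sum_congr rfl key]; simp
    _ = ∑ C ∈ S.powerset.filter (G.IsComponentOf U), #(A ∩ C) := by
        simp_rw [card_filter]
        rw [sum_comm]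
        refine sum_congr rfl fun C _ => ?_
        rw [← card_filter, filter_mem_eq_inter]

lemma sum_fixed_component {S C : Finset V} (hCS : C ⊆ S) (hC : G.IsConnectedOn C) (x y : ℂ) :
    ∑ p ∈ (G.indepSetsIn S ×ˢ G.indepSetsIn S).filter
        (fun p => G.IsComponentOf (p.1 ∪ p.2) C),
      ((#(p.1 ∩ C) : ℂ) - #(p.2 ∩ C)) * (x ^ #p.1 * y ^ #p.2) =
    G.pairWeight C x y * (G.indepSum (G.farFrom S C) x * G.indepSum (G.farFrom S C) y) := by
  rw [pairWeight, indepSum, indepSum, sum_mul_sum, ← sum_product', sum_mul_sum, ← sum_product']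
  refine sum_bij' (fun p _ => ((p.1 ∩ C, p.2 ∩ C), (p.1 \ C, p.2 \ C)))
    (fun q _ => (q.1.1 ∪ q.2.1, q.1.2 ∪ q.2.2)) ?_ ?_ ?_ ?_ ?_
  · rintro ⟨A, B⟩ h
    simp only [mem_filter, mem_product, mem_indepSetsIn, mem_indepPairs,
      isIndepSet_finset_iff] at h ⊢
    obtain ⟨⟨⟨hAS, hA⟩, hBS, hB⟩, ⟨hsub, hcl⟩, -⟩ := h
    refine ⟨⟨?_, ?_, ?_⟩, ⟨?_, ?_⟩, ?_, ?_⟩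
    · exact fun a ha b hb => hA a (mem_inter.mp ha).1 b (mem_inter.mp hb).1
    · exact fun a ha b hb => hB a (mem_inter.mp ha).1 b (mem_inter.mp hb).1
    · rw [← union_inter_distrib_right, inter_eq_right.mpr hsub]
    · intro a ha
      rw [mem_sdiff] at ha
      exact mem_farFrom.mpr ⟨hAS ha.1, ha.2,
        fun c hc hca => ha.2 (hcl c hc a (mem_union_left _ ha.1) hca)⟩
    · exact fun a ha b hb => hA a (mem_sdiff.mp ha).1 b (mem_sdiff.mp hb).1
    · intro a ha
      rw [mem_sdiff] at ha
      exact mem_farFrom.mpr ⟨hBS ha.1, ha.2,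
        fun c hc hca => ha.2 (hcl c hc a (mem_union_right _ ha.1) hca)⟩
    · exact fun a ha b hb => hB a (mem_sdiff.mp ha).1 b (mem_sdiff.mp hb).1
  · rintro ⟨⟨P, Q⟩, A, B⟩ h
    simp only [mem_filter, mem_product, mem_indepSetsIn, mem_indepPairs,
      isIndepSet_finset_iff] at h ⊢
    obtain ⟨⟨hP, hQ, rfl⟩, ⟨hAS, hA⟩, hBS, hB⟩ := h
    have hAf := fun a (ha : a ∈ A) => mem_farFrom.mp (hAS ha)
    have hBf := fun a (ha : a ∈ B) => mem_farFrom.mp (hBS ha)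
    simp only [mem_union] at hAf hBf
    refine ⟨⟨⟨?_, ?_⟩, ?_, ?_⟩, ⟨?_, ?_⟩, hC⟩
    · exact union_subset (subset_union_left.trans hCS) fun a ha => (hAf a ha).1
    · intro a ha b hb hab
      have := hab.symm
      rw [mem_union] at ha hb
      grind
    · exact union_subset (subset_union_right.trans hCS) fun a ha => (hBf a ha).1
    · intro a ha b hb hab
      have := hab.symm
      rw [mem_union] at ha hb
      grind
    · grind
    · intro a ha b hb hab
      simp only [mem_union] at ha hb ⊢
      grind
  · rintro ⟨A, B⟩ -
    simp only [union_comm (_ ∩ C), sdiff_union_inter]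
  · rintro ⟨⟨P, Q⟩, A, B⟩ h
    simp only [mem_product, mem_indepSetsIn, mem_indepPairs] at h
    obtain ⟨⟨-, -, rfl⟩, ⟨hAS, -⟩, hBS, -⟩ := h
    have hAf := fun a (ha : a ∈ A) => (mem_farFrom.mp (hAS ha)).2.1
    have hBf := fun a (ha : a ∈ B) => (mem_farFrom.mp (hBS ha)).2.1
    ext a <;> grind
  · rintro ⟨A, B⟩ -
    dsimp only
    rw [← card_inter_add_card_sdiff A C, ← card_inter_add_card_sdiff B C, pow_add, pow_add]
    ring

lemma sum_card_sub_card (S : Finset V) (x y : ℂ) :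
    ∑ p ∈ G.indepSetsIn S ×ˢ G.indepSetsIn S, ((#p.1 : ℂ) - #p.2) * (x ^ #p.1 * y ^ #p.2) =
    ∑ C ∈ S.powerset.filter G.IsConnectedOn,
      G.pairWeight C x y *
        (G.indepSum (G.farFrom S C) x * G.indepSum (G.farFrom S C) y) := by
  have h1 : ∀ p ∈ G.indepSetsIn S ×ˢ G.indepSetsIn S,
      ((#p.1 : ℂ) - #p.2) * (x ^ #p.1 * y ^ #p.2) =
      ∑ C ∈ S.powerset.filter (G.IsComponentOf (p.1 ∪ p.2)),
        ((#(p.1 ∩ C) : ℂ) - #(p.2 ∩ C)) * (x ^ #p.1 * y ^ #p.2) := by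
    rintro ⟨A, B⟩ h
    simp only [mem_product, mem_indepSetsIn] at h
    have hU := union_subset h.1.1 h.2.1
    rw [← sum_mul, sum_sub_distrib]
    simp only [← Nat.cast_sum]
    rw [← card_eq_sum_card_inter_component hU subset_union_left,
      ← card_eq_sum_card_inter_component hU subset_union_right]
  rw [sum_congr rfl h1, sum_comm' (t' := S.powerset.filter G.IsConnectedOn)
    (s' := fun C => (G.indepSetsIn S ×ˢ G.indepSetsIn S).filter
        (fun p => G.IsComponentOf (p.1 ∪ p.2) C))]
  · refine sum_congr rfl fun C hC => ?_
    simp only [mem_filter, mem_powerset] at hC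
    exact sum_fixed_component hC.1 hC.2 x y
  · intro p C
    simp only [mem_filter, mem_powerset]
    have : G.IsComponentOf (p.1 ∪ p.2) C → G.IsConnectedOn C := fun h => h.2
    tauto

lemma IsConnectedOn.connected_induce {C : Finset V} (hC : G.IsConnectedOn C) :
    (G.induce (C : Set V)).Connected := by
  obtain ⟨⟨v, hv⟩, h⟩ := hC
  rw [connected_iff_exists_forall_reachable]
  refine ⟨⟨v, hv⟩, fun w => ?_⟩
  have hD := h (C.filter fun w => ∃ hw : w ∈ C,
    (G.induce (C : Set V)).Reachable ⟨v, hv⟩ ⟨w, hw⟩) ⟨filter_subset _ _, ?_⟩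
    ⟨v, mem_filter.mpr ⟨hv, hv, Reachable.refl _⟩⟩
  · have hw : (w : V) ∈ C := w.2
    exact (mem_filter.mp (hD.symm.subset hw)).2.2
  · intro a ha b hb hab
    obtain ⟨haC, _, har⟩ := mem_filter.mp ha
    refine mem_filter.mpr ⟨hb, hb, har.trans (Adj.reachable ?_)⟩
    simpa using hab

/-- No vertex of `G` has three pairwise nonadjacent neighbours. -/
def IsClawFree (G : SimpleGraph V) : Prop :=
  ∀ v a b c : V, a ≠ b → a ≠ c → b ≠ c →
    G.Adj v a → G.Adj v b → G.Adj v c → (G.Adj a b ∨ G.Adj a c ∨ G.Adj b c)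

lemma IsClawFree.card_filter_adj_le (h : G.IsClawFree) {P : Finset V}
    (hP : G.IsIndepSet (P : Set V)) (v : V) : #(P.filter (G.Adj v)) ≤ 2 := by
  by_contra! h3
  obtain ⟨a, ha, b, hb, c, hc, hab, hac, hbc⟩ := two_lt_card.mp h3
  rw [mem_filter] at ha hb hc
  rw [isIndepSet_finset_iff] at hP
  rcases h v a b c hab hac hbc ha.2 hb.2 hc.2 with h | h | h
  · exact hP _ ha.1 _ hb.1 h
  · exact hP _ ha.1 _ hc.1 h
  · exact hP _ hb.1 _ hc.1 h

lemma IsClawFree.card_le_card_add_one (h : G.IsClawFree) {P Q : Finset V}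
    (hP : G.IsIndepSet (P : Set V)) (hQ : G.IsIndepSet (Q : Set V))
    (hC : G.IsConnectedOn (P ∪ Q)) : #P ≤ #Q + 1 := by
  have hP' := isIndepSet_finset_iff.mp hP
  have hQ' := isIndepSet_finset_iff.mp hQ
  by_cases hdisj : Disjoint P Q
  · set H := G.induce ((P ∪ Q : Finset V) : Set V)
    have h1 : Nat.card ((P ∪ Q : Finset V) : Set V) ≤ Nat.card H.edgeSet + 1 :=
      hC.connected_induce.card_vert_le_card_edgeSet_add_one
    have hcard : Nat.card ((P ∪ Q : Finset V) : Set V) = #P + #Q := by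
      rw [Nat.card_coe_set_eq, Set.ncard_coe_finset, card_union_of_disjoint hdisj]
    have hsub : H.edgeFinset ⊆
        (univ.filter fun q : ((P ∪ Q : Finset V) : Set V) => (q : V) ∈ Q).biUnion
          fun q => H.incidenceFinset q := by
      intro e
      induction e using Sym2.ind with
      | _ a b =>
        intro he
        rw [mem_edgeFinset, mem_edgeSet] at he
        have hab : G.Adj a b := by simpa [H] using he
        have ha : (a : V) ∈ P ∪ Q := a.2
        have hb : (b : V) ∈ P ∪ Q := b.2
        rw [mem_union] at ha hb
        simp only [mem_biUnion, mem_filter, mem_univ, true_and, mem_incidenceFinset]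
        by_cases haQ : (a : V) ∈ Q
        · exact ⟨a, haQ, he, by simp⟩
        · refine ⟨b, ?_, he, by simp⟩
          exact hb.resolve_left fun hbP => hP' _ (ha.resolve_right haQ) _ hbP hab
    have hdeg : ∀ q ∈ (univ.filter fun q : ((P ∪ Q : Finset V) : Set V) => (q : V) ∈ Q),
        #(H.incidenceFinset q) ≤ 2 := by
      intro q hq
      rw [mem_filter] at hq
      rw [card_incidenceFinset_eq_degree, ← card_neighborFinset_eq_degree]
      refine le_trans ?_ (h.card_filter_adj_le hP (q : V))
      rw [← card_map (Function.Embedding.subtype _)]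
      refine card_le_card fun w hw => ?_
      rw [mem_map] at hw
      obtain ⟨w, hw, rfl⟩ := hw
      rw [mem_neighborFinset] at hw
      have hqw : G.Adj q w := by simpa [H] using hw
      have hwm : (w : V) ∈ P ∪ Q := w.2
      refine mem_filter.mpr ⟨(mem_union.mp hwm).resolve_right fun hwQ => ?_, hqw⟩
      exact hQ' _ hq.2 _ hwQ hqw
    have hcQ : #(univ.filter fun q : ((P ∪ Q : Finset V) : Set V) => (q : V) ∈ Q) ≤ #Q := by
      rw [← card_map (Function.Embedding.subtype _)]
      refine card_le_card fun w hw => ?_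
      rw [mem_map] at hw
      obtain ⟨w, hw, rfl⟩ := hw
      exact (mem_filter.mp hw).2
    have h2 : Nat.card H.edgeSet ≤ #Q * 2 := by
      rw [Nat.card_eq_fintype_card, ← edgeFinset_card]
      exact (card_le_card hsub).trans
        ((card_biUnion_le_card_mul _ _ 2 hdeg).trans (Nat.mul_le_mul_right 2 hcQ))
    omega
  · obtain ⟨v, hvP, hvQ⟩ := not_disjoint_iff.mp hdisj
    have hv := hC.2 {v} ⟨by simp [hvP], ?_⟩ (singleton_nonempty v)
    · have := card_le_card (hv ▸ subset_union_left : P ⊆ {v})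
      rw [card_singleton] at this
      omega
    · intro a ha b hb hab
      rw [mem_singleton] at ha
      subst ha
      exact ((mem_union.mp hb).elim (fun hb => hP' _ hvP _ hb hab)
        (fun hb => hQ' _ hvQ _ hb hab)).elim

lemma IsClawFree.pairWeight_eq (h : G.IsClawFree) {C : Finset V} (hC : G.IsConnectedOn C)
    (x y : ℂ) :
    G.pairWeight C x y =
      (x - y) * ∑ p ∈ (G.indepPairs C).filter (fun p => #p.1 = #p.2 + 1), (x * y) ^ #p.2 := by
  have h1 : ∀ p ∈ G.indepPairs C, ((#p.1 : ℂ) - #p.2) * (x ^ #p.1 * y ^ #p.2) =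
      (if #p.1 = #p.2 + 1 then x * (x * y) ^ #p.2 else 0) -
      (if #p.2 = #p.1 + 1 then y * (x * y) ^ #p.1 else 0) := by
    rintro ⟨P, Q⟩ hp
    obtain ⟨hP, hQ, rfl⟩ := mem_indepPairs.mp hp
    have hPQ := h.card_le_card_add_one hP hQ hC
    have hQP := h.card_le_card_add_one hQ hP (union_comm P Q ▸ hC)
    dsimp only at hP hQ hPQ hQP ⊢
    obtain e | e | e : #P = #Q + 1 ∨ #Q = #P + 1 ∨ #P = #Q := by omega
    · rw [if_pos e, if_neg (by omega), e]
      push_cast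
      ring
    · rw [if_neg (by omega), if_pos e, e]
      push_cast
      ring
    · rw [if_neg (by omega), if_neg (by omega), e]
      ring
  have h2 : ∑ p ∈ G.indepPairs C, (if #p.2 = #p.1 + 1 then y * (x * y) ^ #p.1 else 0) =
      ∑ p ∈ G.indepPairs C, (if #p.1 = #p.2 + 1 then y * (x * y) ^ #p.2 else 0) := by
    refine sum_bij' (fun p _ => p.swap) (fun p _ => p.swap) ?_ ?_ ?_ ?_ ?_ <;>
      simp +contextual [mem_indepPairs, union_comm]
  rw [pairWeight, sum_congr rfl h1, sum_sub_distrib, h2, ← sum_filter, ← sum_filter, ← mul_sum,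
    ← mul_sum, sub_mul]

lemma indepSum_conj (S : Finset V) (z : ℂ) :
    G.indepSum S (conj z) = conj (G.indepSum S z) := by
  simp [indepSum]

lemma IsClawFree.indepSum_ne_zero (h : G.IsClawFree) {z : ℂ} (hz : z.im ≠ 0) (S : Finset V) :
    G.indepSum S z ≠ 0 := by
  induction S using Finset.strongInduction with
  | _ S ih =>
  intro h0
  rcases S.eq_empty_or_nonempty with rfl | ⟨v, hv⟩
  · have : G.indepSetsIn (∅ : Finset V) = {∅} := by
      ext A
      simp +contextual [mem_indepSetsIn]
    simp [indepSum, this] at h0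
  set c : Finset V → ℝ := fun C =>
    (∑ p ∈ (G.indepPairs C).filter (fun p => #p.1 = #p.2 + 1), Complex.normSq z ^ #p.2) *
      Complex.normSq (G.indepSum (G.farFrom S C) z) with hc
  have hlhs : ∑ p ∈ G.indepSetsIn S ×ˢ G.indepSetsIn S,
      ((#p.1 : ℂ) - #p.2) * (z ^ #p.1 * conj z ^ #p.2) = 0 := by
    have e : ∀ p : Finset V × Finset V, ((#p.1 : ℂ) - #p.2) * (z ^ #p.1 * conj z ^ #p.2) =
        (#p.1 * z ^ #p.1) * conj z ^ #p.2 - z ^ #p.1 * (#p.2 * conj z ^ #p.2) := fun p => by ring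
    have h0' : G.indepSum S (conj z) = 0 := by rw [indepSum_conj, h0, map_zero]
    simp_rw [e]
    rw [sum_sub_distrib,
      sum_product' _ _ (fun A B : Finset V => (#A * z ^ #A) * conj z ^ #B),
      sum_product' _ _ (fun A B : Finset V => z ^ #A * (#B * conj z ^ #B)),
      ← sum_mul_sum, ← sum_mul_sum]
    rw [indepSum] at h0 h0'
    rw [h0, h0']
    ring
  have hsum : (z - conj z) * ((∑ C ∈ S.powerset.filter G.IsConnectedOn, c C : ℝ) : ℂ) = 0 := by
    rw [← hlhs, sum_card_sub_card, Complex.ofReal_sum, mul_sum]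
    refine sum_congr rfl fun C hC => ?_
    rw [h.pairWeight_eq (mem_filter.mp hC).2, indepSum_conj, Complex.mul_conj, Complex.mul_conj,
      mul_assoc]
    simp [hc]
  have hzz : z - conj z ≠ 0 := by
    intro hzz
    exact hz (Complex.conj_eq_iff_im.mp (sub_eq_zero.mp hzz).symm)
  have hsum' := Complex.ofReal_eq_zero.mp ((mul_eq_zero.mp hsum).resolve_left hzz)
  have hnonneg : ∀ C, 0 ≤ c C := fun C =>
    mul_nonneg (sum_nonneg fun p _ => pow_nonneg (Complex.normSq_nonneg z) _)
      (Complex.normSq_nonneg _)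
  have hcv := (sum_eq_zero_iff_of_nonneg fun C _ => hnonneg C).mp hsum' {v}
    (mem_filter.mpr ⟨by simpa using hv, isConnectedOn_singleton v⟩)
  rcases mul_eq_zero.mp hcv with h1 | h1
  · have hmem : (({v}, ∅) : Finset V × Finset V) ∈
        (G.indepPairs {v}).filter (fun p => #p.1 = #p.2 + 1) := by
      simp [mem_indepPairs]
    have := (sum_eq_zero_iff_of_nonneg fun p _ =>
      pow_nonneg (Complex.normSq_nonneg z) _).mp h1 _ hmem
    simp at this
  · refine ih (G.farFrom S {v}) ?_ (Complex.normSq_eq_zero.mp h1)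
    refine (ssubset_iff_of_subset (filter_subset _ _)).mpr ⟨v, hv, ?_⟩
    simp

lemma eval_indepPoly [Fintype V] (G : SimpleGraph V) (z : ℂ) :
    ((indepPoly G).map (algebraMap ℝ ℂ)).eval z = G.indepSum univ z := by
  have hcount : ∀ k, indepCount G k = #((G.indepSetsIn univ).filter (#· = k)) := by
    intro k
    rw [indepCount, Nat.card_eq_fintype_card, Fintype.card_subtype]
    congr 1
    ext A
    simp [mem_indepSetsIn, isNClique_iff]
  rw [indepPoly, indepSum, Polynomial.map_sum, Polynomial.eval_finsetSum,
    ← sum_fiberwise_of_maps_to (t := range (Fintype.card V + 1)) (g := card)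
      (fun A _ => mem_range.mpr (Nat.lt_succ_of_le (card_le_univ A)))]
  refine sum_congr rfl fun k _ => ?_
  rw [sum_congr rfl fun A hA => by rw [(mem_filter.mp hA).2]]
  simp [hcount]

end SimpleGraph

/-- If `G` is claw-free (no induced `K_{1,3}`), then all complex roots of the
independence polynomial `I(G,x)` are real. -/
theorem stmt_17 {V : Type*} [Fintype V] (G : SimpleGraph V)
    (hclaw : ∀ v a b c : V, a ≠ b → a ≠ c → b ≠ c →
      G.Adj v a → G.Adj v b → G.Adj v c → (G.Adj a b ∨ G.Adj a c ∨ G.Adj b c)) :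
    ∀ z : ℂ, ((indepPoly G).map (algebraMap ℝ ℂ)).IsRoot z → z.im = 0 := by
  intro z hz
  by_contra him
  rw [Polynomial.IsRoot.def, SimpleGraph.eval_indepPoly] at hz
  exact SimpleGraph.IsClawFree.indepSum_ne_zero hclaw him Finset.univ hz
end
end

section
/- For every finite simple graph G on n vertices, all complex roots of the matching polynomial μ(G,x) are real; equivalently, all complex roots of the matching-generating polynomial M(G,x) are real (and negative). -/
noncomputable section

/-- `m_k(G)`: the number of matchings of `G` consisting of `k` pairwise disjoint edges
(`m_0(G) = 1`). -/
def matchingCount {V : Type*} [Fintype V] (G : SimpleGraph V) (k : ℕ) : ℕ :=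
  Nat.card {m : Finset (Sym2 V) // m.card = k ∧ (↑m : Set (Sym2 V)) ⊆ G.edgeSet ∧
    ∀ e ∈ m, ∀ f ∈ m, e ≠ f → ∀ x : V, x ∈ e → x ∉ f}

/-- The matching polynomial `μ(G,x) = ∑_k (-1)^k m_k(G) x^{n-2k}`. -/
def matchingPoly {V : Type*} [Fintype V] (G : SimpleGraph V) : Polynomial ℝ :=
  ∑ k ∈ Finset.range (Fintype.card V / 2 + 1),
    Polynomial.C ((-1 : ℝ) ^ k * (matchingCount G k : ℝ)) *
      Polynomial.X ^ (Fintype.card V - 2 * k)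

/-- The matching-generating polynomial `M(G,x) = ∑_k m_k(G) x^k`. -/
def matchingGenPoly {V : Type*} [Fintype V] (G : SimpleGraph V) : Polynomial ℝ :=
  ∑ k ∈ Finset.range (Fintype.card V / 2 + 1),
    Polynomial.C (matchingCount G k : ℝ) * Polynomial.X ^ k

open Finset

/-- `m` is a matching of `G` all of whose edges lie inside the vertex set `S`. -/
def IsMatchingWithin {V : Type*} (G : SimpleGraph V) (S : Finset V) (m : Finset (Sym2 V)) : Prop :=
  (↑m : Set (Sym2 V)) ⊆ G.edgeSet ∧
    (∀ e ∈ m, ∀ f ∈ m, e ≠ f → ∀ x : V, x ∈ e → x ∉ f) ∧ ∀ e ∈ m, ∀ x ∈ e, x ∈ S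

section

variable {V : Type*} {G : SimpleGraph V} {S : Finset V} {m : Finset (Sym2 V)}

lemma IsMatchingWithin.two_mul_card_le (h : IsMatchingWithin G S m) : 2 * m.card ≤ S.card := by
  classical
  obtain ⟨hG, hd, hS⟩ := h
  have h1 : (m.biUnion Sym2.toFinset).card = ∑ e ∈ m, e.toFinset.card := by
    refine card_biUnion fun e he f hf hef => ?_
    simp only [Function.onFun, Finset.disjoint_left]
    intro x hx hx'
    exact hd e he f hf hef x (Sym2.mem_toFinset.1 hx) (Sym2.mem_toFinset.1 hx')
  have h2 : ∑ e ∈ m, e.toFinset.card = ∑ e ∈ m, 2 :=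
    sum_congr rfl fun e he =>
      Sym2.card_toFinset_of_not_isDiag e (G.not_isDiag_of_mem_edgeSet (hG he))
  have h3 : m.biUnion Sym2.toFinset ⊆ S := by
    intro x hx
    obtain ⟨e, he, hx⟩ := mem_biUnion.1 hx
    exact hS e he x (Sym2.mem_toFinset.1 hx)
  have := card_le_card h3
  rw [h1, h2, sum_const, smul_eq_mul] at this
  omega

lemma IsMatchingWithin.mk_notMem {v u : V} (h : IsMatchingWithin G S m) (hv : v ∉ S) :
    s(v, u) ∉ m :=
  fun hm => hv (h.2.2 _ hm v (Sym2.mem_mk_left v u))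

lemma IsMatchingWithin.insert_edge [DecidableEq V] {v u : V}
    (h : IsMatchingWithin G ((S.erase v).erase u) m) (hv : v ∈ S) (hu : u ∈ S) (hvu : G.Adj v u) :
    IsMatchingWithin G S (insert s(v, u) m) := by
  obtain ⟨hG, hd, hS⟩ := h
  have hS' : ∀ e ∈ m, ∀ x ∈ e, x ≠ u ∧ x ≠ v ∧ x ∈ S := by simpa using hS
  refine ⟨?_, ?_, ?_⟩
  · intro e he
    rcases mem_insert.1 (mem_coe.1 he) with rfl | he
    · exact hvu
    · exact hG he
  · intro e he f hf hef x hxe hxf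
    rcases mem_insert.1 he with rfl | he <;> rcases mem_insert.1 hf with rfl | hf
    · exact hef rfl
    · have := hS' f hf x hxf
      rcases Sym2.mem_iff.1 hxe with rfl | rfl <;> simp_all
    · have := hS' e he x hxe
      rcases Sym2.mem_iff.1 hxf with rfl | rfl <;> simp_all
    · exact hd e he f hf hef x hxe hxf
  · intro e he x hx
    rcases mem_insert.1 he with rfl | he
    · rcases Sym2.mem_iff.1 hx with rfl | rfl <;> assumption
    · exact (hS' e he x hx).2.2

lemma IsMatchingWithin.erase_edge [DecidableEq V] {v u : V}
    (h : IsMatchingWithin G S m) (hm : s(v, u) ∈ m) :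
    IsMatchingWithin G ((S.erase v).erase u) (m.erase s(v, u)) := by
  obtain ⟨hG, hd, hS⟩ := h
  refine ⟨fun e he => hG (mem_of_mem_erase he), fun e he f hf =>
    hd e (mem_of_mem_erase he) f (mem_of_mem_erase hf), fun e he x hx => ?_⟩
  obtain ⟨hne, he⟩ := mem_erase.1 he
  have hx' := hd e he _ hm hne x hx
  simp only [Sym2.mem_iff, not_or] at hx'
  simp [hx'.1, hx'.2, hS e he x hx]

end

open Classical in
/-- The finset of matchings of `G` inside the vertex set `S`. -/
def matchingsWithin {V : Type*} [Fintype V] (G : SimpleGraph V) (S : Finset V) :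
    Finset (Finset (Sym2 V)) :=
  univ.filter (IsMatchingWithin G S)

/-- The value at `w` of the matching-generating polynomial of `G` induced on `S`. -/
def matchingSum {V : Type*} [Fintype V] (G : SimpleGraph V) (S : Finset V) (w : ℂ) : ℂ :=
  ∑ m ∈ matchingsWithin G S, w ^ m.card

section

variable {V : Type*} [Fintype V] {G : SimpleGraph V} {S : Finset V} {m : Finset (Sym2 V)}

lemma mem_matchingsWithin : m ∈ matchingsWithin G S ↔ IsMatchingWithin G S m := by
  simp [matchingsWithin]

lemma matchingSum_empty (w : ℂ) : matchingSum G ∅ w = 1 := by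
  have h : matchingsWithin G ∅ = {∅} := by
    ext m
    rw [mem_matchingsWithin, mem_singleton]
    constructor
    · rintro ⟨-, -, h⟩
      refine eq_empty_of_forall_notMem fun e he => ?_
      induction e with
      | h a b => simpa using h _ he a (Sym2.mem_mk_left a b)
    · rintro rfl
      simp [IsMatchingWithin]
  simp [matchingSum, h]

open Classical in
/-- The edge recurrence of the matching-generating polynomial at a vertex `v`. -/
lemma matchingSum_eq_erase {v : V} (hv : v ∈ S) (w : ℂ) :
    matchingSum G S w = matchingSum G (S.erase v) w +
      w * ∑ u ∈ (S.erase v).filter (G.Adj v), matchingSum G ((S.erase v).erase u) w := by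
  have hsplit : matchingsWithin G S = matchingsWithin G (S.erase v) ∪
      ((S.erase v).filter (G.Adj v)).biUnion fun u =>
        (matchingsWithin G ((S.erase v).erase u)).image (insert s(v, u)) := by
    ext m
    simp only [mem_union, mem_biUnion, mem_image, mem_matchingsWithin, mem_filter]
    constructor
    · intro h
      by_cases hc : ∃ u, s(v, u) ∈ m
      · obtain ⟨u, hu⟩ := hc
        have hadj : G.Adj v u := h.1 hu
        exact Or.inr ⟨u, ⟨mem_erase.2 ⟨hadj.ne', h.2.2 _ hu u (Sym2.mem_mk_right v u)⟩, hadj⟩,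
          m.erase s(v, u), h.erase_edge hu, insert_erase hu⟩
      · refine Or.inl ⟨h.1, h.2.1, fun e he x hx => mem_erase.2 ⟨?_, h.2.2 e he x hx⟩⟩
        rintro rfl
        obtain ⟨u, rfl⟩ := hx
        exact hc ⟨u, he⟩
    · rintro (h | ⟨u, ⟨hu, hadj⟩, m', h, rfl⟩)
      · exact ⟨h.1, h.2.1, fun e he x hx => mem_of_mem_erase (h.2.2 e he x hx)⟩
      · exact h.insert_edge hv (mem_of_mem_erase hu) hadj
  have hnot : ∀ u, ∀ m' ∈ matchingsWithin G ((S.erase v).erase u), ∀ x, s(v, x) ∉ m' :=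
    fun u m' h x => (mem_matchingsWithin.1 h).mk_notMem (by simp)
  rw [matchingSum, hsplit, sum_union, sum_biUnion, mul_sum]
  · congr 1
    refine sum_congr rfl fun u _ => ?_
    rw [sum_image, matchingSum, mul_sum]
    · refine sum_congr rfl fun m' h => ?_
      rw [card_insert_of_notMem (hnot u m' h u), pow_succ']
    · intro a ha b hb hab
      rw [← erase_insert (hnot u a ha u), hab, erase_insert (hnot u b hb u)]
  · intro u _ u' _ huu'
    simp only [Function.onFun, Finset.disjoint_left, mem_image]
    rintro _ ⟨a, -, rfl⟩ ⟨b, hb, hab⟩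
    have hmem : s(v, u) ∈ insert s(v, u') b := hab ▸ mem_insert_self _ _
    rcases mem_insert.1 hmem with h | h
    · exact huu' (Sym2.congr_right.1 h)
    · exact hnot u' b hb u h
  · simp only [Finset.disjoint_left, mem_biUnion, mem_image, not_exists, not_and]
    rintro m hm u - m' - rfl
    exact (mem_matchingsWithin.1 hm).mk_notMem (notMem_erase v S) (mem_insert_self s(v, u) m')

open Classical in
/-- The Heilmann–Lieb induction: the matching sum does not vanish, and ratios of matching sums
under vertex deletion, suitably rotated, stay in the upper half plane. -/
lemma matchingSum_ne_zero_and_im_pos {z : ℂ} (hz : 0 < z.im) (G : SimpleGraph V) (S : Finset V) :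
    matchingSum G S (-(z ^ 2)⁻¹) ≠ 0 ∧ ∀ v ∈ S,
      0 < (z * matchingSum G S (-(z ^ 2)⁻¹) / matchingSum G (S.erase v) (-(z ^ 2)⁻¹)).im := by
  have hz0 : z ≠ 0 := by rintro rfl; simp at hz
  induction S using Finset.strongInduction with
  | H S ih =>
    have key : ∀ v ∈ S,
        0 < (z * matchingSum G S (-(z ^ 2)⁻¹) / matchingSum G (S.erase v) (-(z ^ 2)⁻¹)).im := by
      intro v hv
      obtain ⟨h0, hpos⟩ := ih _ (erase_ssubset hv)
      have hrec : z * matchingSum G S (-(z ^ 2)⁻¹) / matchingSum G (S.erase v) (-(z ^ 2)⁻¹) =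
          z - ∑ u ∈ (S.erase v).filter (G.Adj v),
            (z * matchingSum G (S.erase v) (-(z ^ 2)⁻¹) /
              matchingSum G ((S.erase v).erase u) (-(z ^ 2)⁻¹))⁻¹ := by
        rw [matchingSum_eq_erase hv]
        simp only [inv_div, ← sum_div, div_mul_eq_div_div]
        generalize ∑ u ∈ (S.erase v).filter (G.Adj v),
          matchingSum G ((S.erase v).erase u) (-(z ^ 2)⁻¹) = T
        generalize matchingSum G (S.erase v) (-(z ^ 2)⁻¹) = B at h0 ⊢
        field_simp
        ring
      rw [hrec, Complex.sub_im, Complex.im_sum]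
      have hsum : ∑ u ∈ (S.erase v).filter (G.Adj v),
          ((z * matchingSum G (S.erase v) (-(z ^ 2)⁻¹) /
            matchingSum G ((S.erase v).erase u) (-(z ^ 2)⁻¹))⁻¹).im ≤ 0 := by
        refine sum_nonpos fun u hu => ?_
        rw [Complex.inv_im]
        exact div_nonpos_of_nonpos_of_nonneg
          (neg_nonpos.2 (hpos u (mem_filter.1 hu).1).le) (Complex.normSq_nonneg _)
      linarith
    refine ⟨?_, key⟩
    rcases S.eq_empty_or_nonempty with rfl | ⟨v, hv⟩
    · simp [matchingSum_empty]
    · intro h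
      simpa [h] using key v hv

/-- The matching sum over a vertex set can only vanish on the negative real axis. -/
lemma im_eq_zero_and_re_neg_of_matchingSum_eq_zero {w : ℂ} (h : matchingSum G S w = 0) :
    w.im = 0 ∧ w.re < 0 := by
  have hw : w ≠ 0 := by
    rintro rfl
    have h0 : ∅ ∈ matchingsWithin G S := mem_matchingsWithin.2 (by simp [IsMatchingWithin])
    have : matchingSum G S 0 = 1 := by
      rw [matchingSum, sum_eq_single_of_mem ∅ h0 fun m _ hm => by simp [hm]]
      simp
    simp [this] at h
  obtain ⟨z, hz⟩ := IsAlgClosed.exists_pow_nat_eq (-w⁻¹) (n := 2) two_pos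
  have hwz : w = -(z ^ 2)⁻¹ := by rw [hz]; simp
  have him : z.im = 0 := by
    rcases lt_trichotomy z.im 0 with hlt | heq | hgt
    · refine absurd h ?_
      have := (matchingSum_ne_zero_and_im_pos (z := -z) (by simpa using hlt) G S).1
      rwa [neg_sq, ← hwz] at this
    · exact heq
    · refine absurd h ?_
      rw [hwz]
      exact (matchingSum_ne_zero_and_im_pos hgt G S).1
  obtain ⟨r, rfl⟩ : ∃ r : ℝ, z = r := ⟨z.re, Complex.ext rfl (by simpa using him)⟩
  have hr : r ≠ 0 := by
    rintro rfl
    simp at hwz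
    exact hw hwz
  have hwr : w = ((-(r ^ 2)⁻¹ : ℝ) : ℂ) := by rw [hwz]; push_cast; rfl
  rw [hwr]
  exact ⟨Complex.ofReal_im _, by rw [Complex.ofReal_re]; exact neg_neg_of_pos (by positivity)⟩

lemma matchingCount_eq_card_filter (G : SimpleGraph V) (k : ℕ) :
    matchingCount G k = ((matchingsWithin G univ).filter fun m => m.card = k).card := by
  classical
  rw [matchingCount, Nat.card_eq_fintype_card, Fintype.card_subtype]
  congr 1
  ext m
  simp only [mem_filter, mem_univ, true_and, mem_matchingsWithin, IsMatchingWithin]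
  tauto

lemma eval_matchingGenPoly (G : SimpleGraph V) (w : ℂ) :
    ((matchingGenPoly G).map (algebraMap ℝ ℂ)).eval w = matchingSum G univ w := by
  have hmaps : ∀ m ∈ matchingsWithin G univ, m.card ∈ range (Fintype.card V / 2 + 1) := by
    intro m hm
    have := (mem_matchingsWithin.1 hm).two_mul_card_le
    rw [card_univ] at this
    rw [mem_range]
    omega
  rw [matchingSum, ← sum_fiberwise_of_maps_to hmaps]
  simp only [matchingGenPoly, Polynomial.map_sum, Polynomial.eval_finsetSum]
  refine sum_congr rfl fun k _ => ?_
  rw [sum_congr rfl fun m hm => by rw [(mem_filter.1 hm).2], sum_const,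
    matchingCount_eq_card_filter]
  simp

lemma eval_matchingPoly (G : SimpleGraph V) {z : ℂ} (hz : z ≠ 0) :
    ((matchingPoly G).map (algebraMap ℝ ℂ)).eval z =
      z ^ Fintype.card V * ((matchingGenPoly G).map (algebraMap ℝ ℂ)).eval (-(z ^ 2)⁻¹) := by
  simp only [matchingPoly, matchingGenPoly, Polynomial.map_sum, Polynomial.eval_finsetSum,
    mul_sum]
  refine sum_congr rfl fun k hk => ?_
  have hk' : 2 * k ≤ Fintype.card V := by
    have := mem_range.1 hk
    omega
  simp only [Polynomial.map_mul, Polynomial.map_pow, Polynomial.map_C, Polynomial.map_X,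
    Polynomial.eval_mul, Polynomial.eval_pow, Polynomial.eval_C, Polynomial.eval_X]
  rw [pow_sub₀ z hz hk', neg_pow (z ^ 2)⁻¹, inv_pow, ← pow_mul]
  simp only [map_mul, map_pow, map_neg, map_one]
  ring

end

/-- All complex roots of the matching polynomial `μ(G,x)` are real; equivalently,
all complex roots of the matching-generating polynomial `M(G,x)` are real
(and negative). -/
theorem stmt_18 {V : Type*} [Fintype V] (G : SimpleGraph V) :
    (∀ z : ℂ, ((matchingPoly G).map (algebraMap ℝ ℂ)).IsRoot z → z.im = 0) ∧
    (∀ z : ℂ, ((matchingGenPoly G).map (algebraMap ℝ ℂ)).IsRoot z →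
      z.im = 0 ∧ z.re < 0) := by
  refine ⟨fun z hz => ?_, fun z hz => ?_⟩
  · by_contra him
    have hz0 : z ≠ 0 := by rintro rfl; simp at him
    rw [Polynomial.IsRoot, eval_matchingPoly G hz0, eval_matchingGenPoly] at hz
    have hsum := (mul_eq_zero.1 hz).resolve_left (pow_ne_zero _ hz0)
    rcases lt_or_gt_of_ne him with hlt | hgt
    · have := (matchingSum_ne_zero_and_im_pos (z := -z) (by simpa using hlt) G univ).1
      rw [neg_sq] at this
      exact this hsum
    · exact (matchingSum_ne_zero_and_im_pos hgt G univ).1 hsum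
  · rw [Polynomial.IsRoot, eval_matchingGenPoly] at hz
    exact im_eq_zero_and_re_neg_of_matchingSum_eq_zero hz
end
end

section
/- For every finite simple graph G, |I(G,−1)| ≤ 2^{φ(G)}, where I(G,−1) is the value of the independence polynomial of G at −1 and φ(G) is the decycling number of G. -/
noncomputable section

/-- The decycling number `φ(G)`: the minimum size of a set `S` of vertices such that
the subgraph induced on the complement of `S` is acyclic. -/
def decyclingNumber {V : Type*} [Fintype V] (G : SimpleGraph V) : ℕ :=
  sInf {k : ℕ | ∃ S : Finset V, S.card = k ∧ (G.induce ((↑S : Set V)ᶜ)).IsAcyclic}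

/-- A finite nonempty acyclic graph has a vertex with at most one neighbour. -/
lemma SimpleGraph.IsAcyclic.exists_subsingleton_neighborSet {V : Type*} [Finite V] [Nonempty V]
    {G : SimpleGraph V} (hG : G.IsAcyclic) : ∃ v, (G.neighborSet v).Subsingleton := by
  classical
  have := Fintype.ofFinite V
  let lengths : Set ℕ := {n | ∃ (u v : V) (p : G.Walk u v), p.IsPath ∧ p.length = n}
  have hbdd : BddAbove lengths := by
    refine ⟨Fintype.card V, ?_⟩
    rintro n ⟨u, v, p, hp, rfl⟩
    exact hp.length_lt.le
  have hne : lengths.Nonempty :=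
    ⟨0, Classical.arbitrary V, Classical.arbitrary V, .nil, .nil, rfl⟩
  obtain ⟨u, v, p, hp, hlen⟩ := Nat.sSup_mem hne hbdd
  have hsnd : ∀ x, G.Adj u x → x = p.snd := by
    intro x hx
    refine hG.eq_snd_of_adj_start hp hx ?_
    by_contra hmem
    have hlonger : p.length + 1 ∈ lengths :=
      ⟨x, v, .cons hx.symm p, hp.cons hmem, rfl⟩
    have := le_csSup hbdd hlonger
    omega
  exact ⟨u, fun x hx y hy ↦ (hsnd x hx).trans (hsnd y hy).symm⟩

open scoped Classical in
/-- The value at `-1` of the independence polynomial of the subgraph of `G` induced on `W`. -/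
def altIndepSum {V : Type*} (G : SimpleGraph V) (W : Finset V) : ℝ :=
  ∑ s ∈ W.powerset.filter (fun s : Finset V ↦ G.IsIndepSet (s : Set V)), (-1) ^ s.card

lemma indepPoly_eval_neg_one {V : Type*} [Fintype V] (G : SimpleGraph V) :
    (indepPoly G).eval (-1 : ℝ) = altIndepSum G Finset.univ := by
  classical
  have hmaps : ∀ s ∈ (Finset.univ : Finset V).powerset.filter
      (fun s : Finset V ↦ G.IsIndepSet (s : Set V)),
      s.card ∈ Finset.range (Fintype.card V + 1) := fun s _ ↦
    Finset.mem_range.2 (Nat.lt_succ_of_le s.card_le_univ)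
  rw [altIndepSum, ← Finset.sum_fiberwise_of_maps_to hmaps, indepPoly,
    Polynomial.eval_finsetSum]
  refine Finset.sum_congr rfl fun k _ ↦ ?_
  rw [Finset.sum_congr rfl (g := fun _ ↦ (-1 : ℝ) ^ k)
    (fun s hs ↦ by rw [(Finset.mem_filter.1 hs).2])]
  rw [Finset.sum_const, nsmul_eq_mul, indepCount, Nat.card_eq_fintype_card, Fintype.card_subtype]
  simp [Finset.filter_filter, SimpleGraph.isNClique_iff]

open scoped Classical in
/-- Deletion of a vertex `v`: independent sets avoid `v`, or contain `v` and avoid its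
neighbours. -/
lemma altIndepSum_insert {V : Type*} (G : SimpleGraph V) {v : V} {W : Finset V} (hv : v ∉ W) :
    altIndepSum G (insert v W) =
      altIndepSum G W - altIndepSum G (W.filter fun w ↦ ¬ G.Adj v w) := by
  simp only [altIndepSum, Finset.sum_filter]
  rw [Finset.sum_powerset_insert hv, sub_eq_add_neg, ← Finset.sum_neg_distrib]
  congr 1
  rw [← Finset.sum_subset (Finset.powerset_mono.2 (Finset.filter_subset (fun w ↦ ¬ G.Adj v w) W))]
  · refine Finset.sum_congr rfl fun s hs ↦ ?_
    have hs' : ∀ w ∈ s, w ∈ W ∧ ¬ G.Adj v w := fun w hw ↦ by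
      simpa using Finset.mem_powerset.1 hs hw
    have hvs : v ∉ s := fun h ↦ hv (hs' v h).1
    have : G.IsIndepSet (↑(insert v s) : Set V) ↔ G.IsIndepSet (s : Set V) := by
      rw [Finset.coe_insert, SimpleGraph.IsIndepSet, SimpleGraph.IsIndepSet, Set.pairwise_insert]
      exact and_iff_left fun w hw _ ↦ ⟨(hs' w hw).2, fun h ↦ (hs' w hw).2 h.symm⟩
    rw [Finset.card_insert_of_notMem hvs]
    simp only [this]
    split_ifs <;> simp [pow_succ]
  · intro s hs hs'
    rw [if_neg]
    intro hind
    refine hs' (Finset.mem_powerset.2 fun w hw ↦ ?_)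
    have hwW := Finset.mem_powerset.1 hs hw
    exact Finset.mem_filter.2 ⟨hwW, hind (by simp) (by simp [hw]) fun h ↦ hv (h ▸ hwW)⟩

lemma altIndepSum_empty {V : Type*} (G : SimpleGraph V) : altIndepSum G ∅ = 1 := by
  simp [altIndepSum, Finset.sum_filter]

/-- An isolated vertex makes the alternating sum vanish. -/
lemma altIndepSum_insert_of_forall_not_adj {V : Type*} [DecidableEq V] (G : SimpleGraph V) {v : V}
    {W : Finset V} (hv : v ∉ W) (h : ∀ w ∈ W, ¬ G.Adj v w) :
    altIndepSum G (insert v W) = 0 := by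
  classical
  have := altIndepSum_insert G hv
  rw [Finset.filter_true_of_mem h, sub_self] at this
  convert this

lemma SimpleGraph.IsAcyclic.induce_mono {V : Type*} {G : SimpleGraph V} {s t : Set V}
    (h : (G.induce t).IsAcyclic) (hst : s ⊆ t) : (G.induce s).IsAcyclic :=
  h.embedding (SimpleGraph.induceHomOfLE G hst)

lemma abs_altIndepSum_le_one {V : Type*} (G : SimpleGraph V) (W : Finset V)
    (hW : (G.induce (W : Set V)).IsAcyclic) : |altIndepSum G W| ≤ 1 := by
  classical
  induction W using Finset.strongInduction with
  | H W ih =>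
    rcases W.eq_empty_or_nonempty with rfl | hne
    · simp [altIndepSum_empty]
    have : Nonempty (W : Set V) := hne.to_subtype
    obtain ⟨⟨u, hu⟩, hsub⟩ := hW.exists_subsingleton_neighborSet
    have huniq : ∀ x ∈ W, ∀ y ∈ W, G.Adj u x → G.Adj u y → x = y := fun x hx y hy hux huy ↦
      congrArg Subtype.val (hsub (x := ⟨x, hx⟩) hux (y := ⟨y, hy⟩) huy)
    replace hu : u ∈ W := hu
    by_cases hnbr : ∃ v ∈ W, G.Adj u v
    · obtain ⟨v, hv, huv⟩ := hnbr
      have hzero : altIndepSum G (W.erase v) = 0 := by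
        rw [← Finset.insert_erase (Finset.mem_erase.2 ⟨huv.ne, hu⟩)]
        refine altIndepSum_insert_of_forall_not_adj G (by simp) fun w hw huw ↦ ?_
        simp only [Finset.mem_erase] at hw
        exact hw.2.1 (huniq w hw.2.2 v hv huw huv)
      have hrec := altIndepSum_insert G (Finset.notMem_erase v W)
      rw [Finset.insert_erase hv, hzero, zero_sub] at hrec
      rw [hrec, abs_neg]
      have hss := (Finset.filter_subset (fun w ↦ ¬ G.Adj v w) (W.erase v)).trans_ssubset
        (Finset.erase_ssubset hv)
      exact ih _ hss (hW.induce_mono (Finset.coe_subset.2 hss.subset))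
    · push Not at hnbr
      rw [← Finset.insert_erase hu, altIndepSum_insert_of_forall_not_adj G (by simp)
        fun w hw ↦ hnbr w (Finset.mem_of_mem_erase hw)]
      simp

lemma abs_altIndepSum_le_two_pow {V : Type*} (G : SimpleGraph V) (S W : Finset V)
    (hW : (G.induce ((W : Set V) \ S)).IsAcyclic) : |altIndepSum G W| ≤ 2 ^ S.card := by
  classical
  induction S using Finset.induction_on generalizing W with
  | empty => simpa using abs_altIndepSum_le_one G W (hW.induce_mono (by simp))
  | insert v S hv ih =>
    rw [Finset.card_insert_of_notMem hv, pow_succ]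
    have key : ∀ W' ⊆ W.erase v, |altIndepSum G W'| ≤ 2 ^ S.card := fun W' hW' ↦
      ih W' <| hW.induce_mono fun x hx ↦ by
        have := Finset.mem_erase.1 (hW' hx.1)
        simp_all
    by_cases hvW : v ∈ W
    · have hrec := altIndepSum_insert G (Finset.notMem_erase v W)
      rw [Finset.insert_erase hvW] at hrec
      rw [hrec]
      have h₁ := key _ subset_rfl
      have h₂ := key _ (Finset.filter_subset (fun w ↦ ¬ G.Adj v w) (W.erase v))
      have := abs_sub (altIndepSum G (W.erase v))
        (altIndepSum G ((W.erase v).filter fun w ↦ ¬ G.Adj v w))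
      linarith
    · have := key W (Finset.erase_eq_of_notMem hvW).ge
      have : (0 : ℝ) < 2 ^ S.card := by positivity
      linarith

/-- `|I(G,-1)| ≤ 2^{φ(G)}`. -/
theorem stmt_19 {V : Type*} [Fintype V] (G : SimpleGraph V) :
    |(indepPoly G).eval (-1 : ℝ)| ≤ 2 ^ (decyclingNumber G) := by
  have hne : {k : ℕ | ∃ S : Finset V, S.card = k ∧
      (G.induce ((↑S : Set V)ᶜ)).IsAcyclic}.Nonempty := by
    refine ⟨_, Finset.univ, rfl, ?_⟩
    have : IsEmpty (((Finset.univ : Finset V) : Set V)ᶜ : Set V) := by simp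
    exact .of_subsingleton
  obtain ⟨S, hcard, hS⟩ := Nat.sInf_mem hne
  rw [indepPoly_eval_neg_one, decyclingNumber, ← hcard]
  exact abs_altIndepSum_le_two_pow G S _ (hS.induce_mono fun x hx ↦ hx.2)
end
end
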